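/- Let H₀ ≠ 0 and f₀ ≠ 0 be real constants and J ⊆ ℝ an open interval. If g : J → ℝ is a twice differentiable function with |f₀·g'(y)| > 1 for all y ∈ J satisfying 2H₀ = f₀·g''(y)/((f₀·g'(y))² − 1)^{3/2} on J, then there exist constants λ₃, λ₄ ∈ ℝ and a sign ε ∈ {−1,1} such that f₀·g(y) = (ε/(2H₀))·√((2H₀·y + λ₃)² − 1) + λ₄ for all y ∈ J. -/

import Mathlib

/-- A function with vanishing derivative on an open interval is constant there. -/
theorem exists_eq_const_of_hasDerivAt_zero {J : Set ℝ} (hJo : IsOpen J) (hJc : J.OrdConnected)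
    {F : ℝ → ℝ} (hF : ∀ y ∈ J, HasDerivAt F 0 y) : ∃ c, ∀ y ∈ J, F y = c :=
  hJo.exists_is_const_of_deriv_eq_zero hJc.isPreconnected
    (fun y hy => (hF y hy).differentiableAt.differentiableWithinAt) fun y hy => (hF y hy).deriv

theorem Real.rpow_three_halves_eq_sqrt_pow {x : ℝ} (hx : 0 ≤ x) :
    x ^ ((3 : ℝ) / 2) = √x ^ 3 := by
  rw [Real.sqrt_eq_rpow, ← Real.rpow_natCast, ← Real.rpow_mul hx]
  norm_num

theorem HasDerivAt.sqrt_sq_sub_one {p : ℝ → ℝ} {p' y : ℝ} (hp : HasDerivAt p p' y)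
    (hpos : 0 < p y ^ 2 - 1) :
    HasDerivAt (fun x => √(p x ^ 2 - 1)) (p y * p' / √(p y ^ 2 - 1)) y := by
  have hs := Real.sqrt_pos.2 hpos
  refine (((hp.fun_pow 2).sub_const 1).sqrt hpos.ne').congr_deriv ?_
  generalize √(p y ^ 2 - 1) = s at hs ⊢
  field_simp
  norm_num
  ring

/-- The ODE (3.8): a timelike CMC factorable surface of first kind with constant `f₀`:
if `2H₀ = f₀ g''/((f₀ g')² - 1)^{3/2}` with `|f₀ g'| > 1` on an open interval, then
`f₀ g(y) = (ε/(2H₀)) √((2H₀ y + lam₃)² - 1) + lam₄` for some sign `ε`. -/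
theorem ode_timelike_cmc_first_kind
    (H₀ f₀ : ℝ) (hH₀ : H₀ ≠ 0) (hf₀ : f₀ ≠ 0)
    (J : Set ℝ) (hJo : IsOpen J) (hJc : J.OrdConnected) (hJn : J.Nonempty)
    (g : ℝ → ℝ) (hg : ∀ y ∈ J, DifferentiableAt ℝ g y)
    (hg' : ∀ y ∈ J, DifferentiableAt ℝ (deriv g) y)
    (hbd : ∀ y ∈ J, |f₀ * deriv g y| > 1)
    (hode : ∀ y ∈ J,
      2 * H₀ = f₀ * deriv (deriv g) y / ((f₀ * deriv g y) ^ 2 - 1) ^ ((3 : ℝ) / 2)) :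
    ∃ (lam₃ lam₄ ε : ℝ), (ε = 1 ∨ ε = -1) ∧ ∀ y ∈ J,
      f₀ * g y = (ε / (2 * H₀)) * Real.sqrt ((2 * H₀ * y + lam₃) ^ 2 - 1) + lam₄ := by
  have hpos : ∀ y ∈ J, 0 < (f₀ * deriv g y) ^ 2 - 1 := fun y hy => by
    linarith [(one_lt_sq_iff_one_lt_abs _).2 (hbd y hy)]
  have hsqrt : ∀ y ∈ J, 0 < √((f₀ * deriv g y) ^ 2 - 1) := fun y hy => Real.sqrt_pos.2 (hpos y hy)
  have hsq : ∀ y ∈ J, √((f₀ * deriv g y) ^ 2 - 1) ^ 2 = (f₀ * deriv g y) ^ 2 - 1 := fun y hy =>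
    Real.sq_sqrt (hpos y hy).le
  have hp : ∀ y ∈ J, HasDerivAt (fun x => f₀ * deriv g x)
      (2 * H₀ * √((f₀ * deriv g y) ^ 2 - 1) ^ 3) y := fun y hy => by
    refine ((hg' y hy).hasDerivAt.const_mul f₀).congr_deriv ?_
    have h := hode y hy
    rw [Real.rpow_three_halves_eq_sqrt_pow (hpos y hy).le,
      eq_div_iff (pow_pos (hsqrt y hy) 3).ne'] at h
    exact h.symm
  obtain ⟨c, hc⟩ := exists_eq_const_of_hasDerivAt_zero hJo hJc
    (F := fun y => f₀ * deriv g y / √((f₀ * deriv g y) ^ 2 - 1) + 2 * H₀ * y) fun y hy => by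
      have hs := hsqrt y hy
      refine (((hp y hy).div ((hp y hy).sqrt_sq_sub_one (hpos y hy)) hs.ne').add
        ((hasDerivAt_id y).const_mul (2 * H₀))).congr_deriv ?_
      have h2 := hsq y hy
      generalize √((f₀ * deriv g y) ^ 2 - 1) = s at hs h2 ⊢
      generalize f₀ * deriv g y = p at h2 ⊢
      field_simp
      rw [h2]
      ring
  obtain ⟨d, hd⟩ := exists_eq_const_of_hasDerivAt_zero hJo hJc
    (F := fun y => (√((f₀ * deriv g y) ^ 2 - 1))⁻¹ + 2 * H₀ * (f₀ * g y)) fun y hy => by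
      have hs := hsqrt y hy
      refine ((((hp y hy).sqrt_sq_sub_one (hpos y hy)).inv hs.ne').add
        (((hg y hy).hasDerivAt.const_mul f₀).const_mul (2 * H₀))).congr_deriv ?_
      generalize √((f₀ * deriv g y) ^ 2 - 1) = s at hs ⊢
      field_simp
      ring
  refine ⟨-c, d / (2 * H₀), -1, Or.inr rfl, fun y hy => ?_⟩
  have hs := hsqrt y hy
  have hroot : √((2 * H₀ * y + -c) ^ 2 - 1) = (√((f₀ * deriv g y) ^ 2 - 1))⁻¹ := by
    rw [← Real.sqrt_sq (inv_pos.2 hs).le, ← hc y hy]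
    congr 1
    have h2 := hsq y hy
    generalize √((f₀ * deriv g y) ^ 2 - 1) = s at hs h2 ⊢
    generalize f₀ * deriv g y = p at h2 ⊢
    field_simp
    linear_combination -h2
  rw [hroot, ← hd y hy]
  field_simp
  ring
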